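/- In the normal sequence model with the prior under which the coordinates θ_i are i.i.d. from the horseshoe prior with global parameter τ = (s_n/n)√(log(n/s_n)), where s_n is a sequence with s_n → ∞ and s_n/n → 0, the posterior contracts at the rate √(s_n log n): for every sequence M_n → ∞, sup over θ0 ∈ ℓ0[s_n] of E_{θ0} Π(θ : ‖θ − θ0‖ > M_n √(s_n log n) | Y) → 0 as n → ∞. -/

import Mathlib

open MeasureTheory Filter
open scoped ENNReal

/-- The standard normal density. -/
noncomputable def gaussDensity (x : ℝ) : ℝ :=
  Real.exp (-(x ^ 2) / 2) / Real.sqrt (2 * Real.pi)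

/-- Likelihood of the data `y` in the normal sequence model `Y = θ + ε`, `ε ~ N(0, Iₙ)`. -/
noncomputable def seqLik (n : ℕ) (θ y : Fin n → ℝ) : ℝ :=
  ∏ i, gaussDensity (y i - θ i)

/-- The nearly-black class `ℓ₀[s]`. -/
def nearlyBlack (n s : ℕ) : Set (Fin n → ℝ) :=
  {θ | Set.ncard {i | θ i ≠ 0} ≤ s}

/-- The marginal density of the horseshoe prior with global parameter `τ`:
`θ | λ ~ N(0, λ²)`, `λ` half-Cauchy with scale `τ`. -/
noncomputable def horseshoeDensity (τ θ : ℝ) : ℝ :=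
  ∫ l in Set.Ioi (0 : ℝ),
    Real.exp (-(θ ^ 2) / (2 * l ^ 2)) / Real.sqrt (2 * Real.pi * l ^ 2) *
      (2 * τ / (Real.pi * (τ ^ 2 + l ^ 2)))

/-- The prior on `ℝⁿ` with i.i.d. horseshoe coordinates with global parameter `τ`. -/
noncomputable def horseshoePrior (n : ℕ) (τ : ℝ) : Measure (Fin n → ℝ) :=
  Measure.pi fun _ => volume.withDensity fun θ => ENNReal.ofReal (horseshoeDensity τ θ)

/-- Posterior probability `Π(A | Y = y)` for the prior `prior` in the sequence model. -/
noncomputable def seqPost (n : ℕ) (prior : Measure (Fin n → ℝ)) (y : Fin n → ℝ)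
    (A : Set (Fin n → ℝ)) : ℝ≥0∞ :=
  (∫⁻ θ in A, ENNReal.ofReal (seqLik n θ y) ∂prior) /
    ∫⁻ θ, ENNReal.ofReal (seqLik n θ y) ∂prior

/-- Expected posterior mass `E_{θ₀} Π(A | Y)` under the true mean `θ₀`. -/
noncomputable def seqPostExp (n : ℕ) (prior : Measure (Fin n → ℝ)) (θ0 : Fin n → ℝ)
    (A : Set (Fin n → ℝ)) : ℝ≥0∞ :=
  ∫⁻ y, seqPost n prior y A * ENNReal.ofReal (seqLik n θ0 y)

open Set

lemma lintegral_pi_prod {n : ℕ} {μ : Fin n → Measure ℝ} [∀ i, SigmaFinite (μ i)]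
    {f : Fin n → ℝ → ℝ≥0∞} (hf : ∀ i, Measurable (f i)) :
    ∫⁻ x, ∏ i, f i (x i) ∂(Measure.pi μ) = ∏ i, ∫⁻ t, f i t ∂(μ i) := by
  induction n with
  | zero => simp
  | succ n ih =>
    have hprod : Measurable fun x : Fin n → ℝ => ∏ j : Fin n, f j.succ (x j) :=
      Finset.measurable_fun_prod _ fun j _ => (hf j.succ).comp (measurable_pi_apply j)
    calc ∫⁻ x, ∏ i, f i (x i) ∂(Measure.pi μ)
        = ∫⁻ z : ℝ × (Fin n → ℝ), f 0 z.1 * ∏ j : Fin n, f j.succ (z.2 j)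
            ∂((μ 0).prod (Measure.pi fun j => μ j.succ)) := by
          rw [← (measurePreserving_piFinSuccAbove μ 0).symm.lintegral_comp_emb
            (MeasurableEquiv.measurableEmbedding _)]
          simp only [Fin.prod_univ_succ]
          rfl
      _ = _ := by
          rw [lintegral_prod_mul (hf 0).aemeasurable hprod.aemeasurable,
            ih fun j => hf j.succ, Fin.prod_univ_succ]

lemma lintegral_pi_mul_prod {n : ℕ} {μ : Fin n → Measure ℝ} [∀ i, SigmaFinite (μ i)]
    {f : Fin n → ℝ → ℝ≥0∞} (hf : ∀ i, Measurable (f i)) {g : ℝ → ℝ≥0∞} (hg : Measurable g)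
    (i : Fin n) :
    ∫⁻ x, g (x i) * ∏ j, f j (x j) ∂(Measure.pi μ) =
      (∫⁻ t, g t * f i t ∂(μ i)) * ∏ j ∈ Finset.univ.erase i, ∫⁻ t, f j t ∂(μ j) := by
  set F : Fin n → ℝ → ℝ≥0∞ := Function.update f i fun t => g t * f i t with hF
  have hFi : F i = fun t => g t * f i t := by simp [hF]
  have hFj : ∀ j ∈ Finset.univ.erase i, F j = f j := fun j hj => by
    simp [hF, Function.update_of_ne (Finset.ne_of_mem_erase hj)]
  have hFm : ∀ j, Measurable (F j) := fun j => by
    by_cases h : j = i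
    · subst h; rw [hFi]; exact hg.mul (hf j)
    · simpa [hF, Function.update_of_ne h] using hf j
  have key : ∀ x : Fin n → ℝ, g (x i) * ∏ j, f j (x j) = ∏ j, F j (x j) := fun x => by
    rw [← Finset.mul_prod_erase _ _ (Finset.mem_univ i),
      ← Finset.mul_prod_erase _ (fun j => F j (x j)) (Finset.mem_univ i), hFi, ← mul_assoc]
    congr 1
    exact Finset.prod_congr rfl fun j hj => by rw [hFj j hj]
  simp_rw [key]
  rw [lintegral_pi_prod hFm, ← Finset.mul_prod_erase _ _ (Finset.mem_univ i), hFi]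
  congr 1
  exact Finset.prod_congr rfl fun j hj => by rw [hFj j hj]

lemma gaussDensity_eq (x m : ℝ) :
    gaussDensity (x - m) = ProbabilityTheory.gaussianPDFReal m 1 x := by
  simp [gaussDensity, ProbabilityTheory.gaussianPDFReal, div_eq_inv_mul]

lemma gaussDensity_pos (x : ℝ) : 0 < gaussDensity x := by
  unfold gaussDensity; positivity

@[fun_prop]
lemma continuous_gaussDensity : Continuous gaussDensity := by
  unfold gaussDensity; fun_prop

@[fun_prop]
lemma measurable_gaussDensity : Measurable gaussDensity := continuous_gaussDensity.measurable

lemma gaussDensity_neg (x : ℝ) : gaussDensity (-x) = gaussDensity x := by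
  simp [gaussDensity]

lemma gaussDensity_sub_comm (x y : ℝ) : gaussDensity (x - y) = gaussDensity (y - x) := by
  rw [← gaussDensity_neg, neg_sub]

lemma gaussDensity_le_exp (x : ℝ) : gaussDensity x ≤ Real.exp (-(x ^ 2) / 2) := by
  refine div_le_self (Real.exp_pos _).le (Real.one_le_sqrt.2 ?_)
  linarith [Real.pi_gt_three]

lemma gaussDensity_le_one (x : ℝ) : gaussDensity x ≤ 1 :=
  (gaussDensity_le_exp x).trans (Real.exp_le_one_iff.2 (by nlinarith [sq_nonneg x]))

lemma lintegral_gaussDensity_sub (m : ℝ) :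
    ∫⁻ x, ENNReal.ofReal (gaussDensity (x - m)) = 1 := by
  simp_rw [gaussDensity_eq]
  exact ProbabilityTheory.lintegral_gaussianPDFReal_eq_one m one_ne_zero

lemma ofReal_seqLik {n : ℕ} (θ y : Fin n → ℝ) :
    ENNReal.ofReal (seqLik n θ y) = ∏ i, ENNReal.ofReal (gaussDensity (y i - θ i)) :=
  ENNReal.ofReal_prod_of_nonneg fun _ _ => (gaussDensity_pos _).le

/-- The marginal density at `y` of one observation whose mean has prior `μ`. -/
noncomputable def coordMarginal (μ : Measure ℝ) (y : ℝ) : ℝ≥0∞ :=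
  ∫⁻ θ, ENNReal.ofReal (gaussDensity (y - θ)) ∂μ

/-- The unnormalised posterior second moment about `t` given one observation `y`. -/
noncomputable def coordSqLoss (μ : Measure ℝ) (t y : ℝ) : ℝ≥0∞ :=
  ∫⁻ θ, ENNReal.ofReal ((θ - t) ^ 2) * ENNReal.ofReal (gaussDensity (y - θ)) ∂μ

/-- The expected posterior squared loss of one coordinate with true mean `t`. -/
noncomputable def coordRisk (μ : Measure ℝ) (t : ℝ) : ℝ≥0∞ :=
  ∫⁻ y, coordSqLoss μ t y / coordMarginal μ y * ENNReal.ofReal (gaussDensity (y - t))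

lemma measurable_coordMarginal (μ : Measure ℝ) [SFinite μ] : Measurable (coordMarginal μ) := by
  unfold coordMarginal
  exact Measurable.lintegral_prod_right' (f := fun p : ℝ × ℝ =>
    ENNReal.ofReal (gaussDensity (p.1 - p.2))) (by fun_prop)

lemma measurable_coordSqLoss (μ : Measure ℝ) [SFinite μ] (t : ℝ) :
    Measurable (coordSqLoss μ t) := by
  unfold coordSqLoss
  exact Measurable.lintegral_prod_right' (f := fun p : ℝ × ℝ =>
    ENNReal.ofReal ((p.2 - t) ^ 2) * ENNReal.ofReal (gaussDensity (p.1 - p.2))) (by fun_prop)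

lemma coordMarginal_ne_top (μ : Measure ℝ) [IsFiniteMeasure μ] (y : ℝ) :
    coordMarginal μ y ≠ ∞ := by
  refine ne_top_of_le_ne_top (measure_ne_top μ univ) ?_
  rw [← lintegral_one]
  exact lintegral_mono fun θ => by
    simpa using ENNReal.ofReal_le_ofReal (gaussDensity_le_one (y - θ))

/-- A Markov inequality for the posterior: for a product prior, the probability that the squared
loss exceeds `r ^ 2` is controlled by the sum of the coordinatewise posterior second moments. -/
lemma seqPost_le {n : ℕ} (μ : Measure ℝ) [IsFiniteMeasure μ]
    (hμ : ∀ y, coordMarginal μ y ≠ 0) (θ0 y : Fin n → ℝ) {r : ℝ} (hr : 0 < r) :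
    seqPost n (Measure.pi fun _ => μ) y {θ | r < Real.sqrt (∑ i, (θ i - θ0 i) ^ 2)} ≤
      (∑ i, coordSqLoss μ (θ0 i) (y i) / coordMarginal μ (y i)) / ENNReal.ofReal (r ^ 2) := by
  have hφ : ∀ i, Measurable fun t : ℝ => ENNReal.ofReal (gaussDensity (y i - t)) :=
    fun i => by fun_prop
  have hr2 : ENNReal.ofReal (r ^ 2) ≠ 0 := by simpa using hr.ne'
  have hden : ∫⁻ θ, ENNReal.ofReal (seqLik n θ y) ∂(Measure.pi fun _ => μ) =
      ∏ i, coordMarginal μ (y i) := by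
    simp_rw [ofReal_seqLik]
    exact lintegral_pi_prod hφ
  have hterm : ∀ i, ∫⁻ θ, ENNReal.ofReal ((θ i - θ0 i) ^ 2) * ENNReal.ofReal (seqLik n θ y)
      ∂(Measure.pi fun _ => μ) =
        coordSqLoss μ (θ0 i) (y i) * ∏ j ∈ Finset.univ.erase i, coordMarginal μ (y j) := fun i => by
    simp_rw [ofReal_seqLik]
    exact lintegral_pi_mul_prod hφ (g := fun t => ENNReal.ofReal ((t - θ0 i) ^ 2))
      (by fun_prop) i
  have hlik : Measurable fun θ : Fin n → ℝ => ENNReal.ofReal (seqLik n θ y) := by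
    unfold seqLik; fun_prop
  have hP0 : ∀ i, ∏ j ∈ Finset.univ.erase i, coordMarginal μ (y j) ≠ 0 := fun i =>
    Finset.prod_ne_zero_iff.2 fun j _ => hμ _
  have hPt : ∀ i, ∏ j ∈ Finset.univ.erase i, coordMarginal μ (y j) ≠ ∞ := fun i =>
    ENNReal.prod_ne_top fun j _ => coordMarginal_ne_top μ _
  have hset : MeasurableSet {θ : Fin n → ℝ | r < Real.sqrt (∑ i, (θ i - θ0 i) ^ 2)} :=
    measurableSet_lt (by fun_prop) (by fun_prop)
  have hnum : ∫⁻ θ in {θ | r < Real.sqrt (∑ i, (θ i - θ0 i) ^ 2)},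
      ENNReal.ofReal (seqLik n θ y) ∂(Measure.pi fun _ => μ) ≤
      (∑ i, coordSqLoss μ (θ0 i) (y i) * ∏ j ∈ Finset.univ.erase i, coordMarginal μ (y j)) /
        ENNReal.ofReal (r ^ 2) := by
    rw [ENNReal.le_div_iff_mul_le (Or.inl hr2) (Or.inl ENNReal.ofReal_ne_top), mul_comm,
      ← lintegral_const_mul _ hlik]
    calc _ ≤ ∫⁻ θ in {θ | r < Real.sqrt (∑ i, (θ i - θ0 i) ^ 2)},
          ∑ i, ENNReal.ofReal ((θ i - θ0 i) ^ 2) * ENNReal.ofReal (seqLik n θ y)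
            ∂(Measure.pi fun _ => μ) := by
          refine setLIntegral_mono' hset fun θ hθ => ?_
          rw [← Finset.sum_mul, ← ENNReal.ofReal_sum_of_nonneg fun _ _ => sq_nonneg _]
          gcongr
          exact (Real.lt_sqrt hr.le).1 hθ |>.le
      _ ≤ ∫⁻ θ, ∑ i, ENNReal.ofReal ((θ i - θ0 i) ^ 2) * ENNReal.ofReal (seqLik n θ y)
            ∂(Measure.pi fun _ => μ) := setLIntegral_le_lintegral _ _
      _ = _ := by
          rw [lintegral_finsetSum _ fun i _ => by fun_prop]
          simp_rw [hterm]
  unfold seqPost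
  rw [hden]
  refine (ENNReal.div_le_div_right hnum _).trans (le_of_eq ?_)
  rw [ENNReal.div_right_comm]
  congr 1
  simp_rw [div_eq_mul_inv, Finset.sum_mul, ← div_eq_mul_inv]
  refine Finset.sum_congr rfl fun i _ => ?_
  rw [← Finset.mul_prod_erase _ _ (Finset.mem_univ i)]
  exact ENNReal.mul_div_mul_right _ _ (hP0 i) (hPt i)

lemma seqPostExp_le {n : ℕ} (μ : Measure ℝ) [IsFiniteMeasure μ]
    (hμ : ∀ y, coordMarginal μ y ≠ 0) (θ0 : Fin n → ℝ) {r : ℝ} (hr : 0 < r) :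
    seqPostExp n (Measure.pi fun _ => μ) θ0 {θ | r < Real.sqrt (∑ i, (θ i - θ0 i) ^ 2)} ≤
      (∑ i, coordRisk μ (θ0 i)) / ENNReal.ofReal (r ^ 2) := by
  have hR : ∀ t, Measurable fun y => coordSqLoss μ t y / coordMarginal μ y := fun t =>
    (measurable_coordSqLoss μ t).div (measurable_coordMarginal μ)
  have hφ : ∀ i, Measurable fun t : ℝ => ENNReal.ofReal (gaussDensity (t - θ0 i)) :=
    fun i => by fun_prop
  have hlik : Measurable fun y : Fin n → ℝ => ENNReal.ofReal (seqLik n θ0 y) := by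
    unfold seqLik; fun_prop
  have hM : ∀ i, Measurable fun y : Fin n → ℝ =>
      coordSqLoss μ (θ0 i) (y i) / coordMarginal μ (y i) * ENNReal.ofReal (seqLik n θ0 y) :=
    fun i => ((hR _).comp (measurable_pi_apply i)).mul hlik
  unfold seqPostExp
  calc _ ≤ ∫⁻ y : Fin n → ℝ, (∑ i, coordSqLoss μ (θ0 i) (y i) / coordMarginal μ (y i) *
          ENNReal.ofReal (seqLik n θ0 y)) * (ENNReal.ofReal (r ^ 2))⁻¹ := by
        refine lintegral_mono fun y => ?_
        rw [← Finset.sum_mul, mul_right_comm, ← div_eq_mul_inv]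
        gcongr
        exact seqPost_le μ hμ θ0 y hr
    _ = _ := by
        rw [lintegral_mul_const _ (Finset.measurable_fun_sum _ fun i _ => hM i), div_eq_mul_inv,
          lintegral_finsetSum _ fun i _ => hM i]
        congr 1
        refine Finset.sum_congr rfl fun i _ => ?_
        simp_rw [ofReal_seqLik, volume_pi]
        rw [lintegral_pi_mul_prod hφ (hR (θ0 i)) i]
        simp [lintegral_gaussDensity_sub, coordRisk]

/-- The joint density of `(θ, l)` under the horseshoe prior. -/
noncomputable def horseshoeKernel (τ θ l : ℝ) : ℝ :=
  Real.exp (-(θ ^ 2) / (2 * l ^ 2)) / Real.sqrt (2 * Real.pi * l ^ 2) *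
    (2 * τ / (Real.pi * (τ ^ 2 + l ^ 2)))

lemma horseshoeKernel_nonneg {τ : ℝ} (hτ : 0 < τ) (θ l : ℝ) : 0 ≤ horseshoeKernel τ θ l := by
  unfold horseshoeKernel
  have := Real.pi_pos
  positivity

lemma measurable_horseshoeKernel (τ : ℝ) :
    Measurable fun p : ℝ × ℝ => horseshoeKernel τ p.1 p.2 := by
  unfold horseshoeKernel
  fun_prop

lemma horseshoeDensity_eq (τ θ : ℝ) :
    horseshoeDensity τ θ = ∫ l in Ioi (0 : ℝ), horseshoeKernel τ θ l := rfl

lemma measurable_horseshoeDensity (τ : ℝ) : Measurable (horseshoeDensity τ) := by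
  have h := (measurable_horseshoeKernel τ).stronglyMeasurable.integral_prod_right'
    (ν := volume.restrict (Ioi (0 : ℝ)))
  exact h.measurable

lemma integrable_div_sq_add_sq {a : ℝ} (ha : 0 < a) :
    Integrable (fun l : ℝ => a / (a ^ 2 + l ^ 2)) ∧
      ∫ l : ℝ, a / (a ^ 2 + l ^ 2) = Real.pi := by
  have hne : NNReal.mk a ha.le ≠ 0 := fun h => ha.ne' (congrArg NNReal.toReal h)
  have heq : (fun l : ℝ => a / (a ^ 2 + l ^ 2)) =
      fun l => Real.pi * ProbabilityTheory.cauchyPDFReal 0 (.mk a ha.le) l := by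
    funext l
    rw [ProbabilityTheory.cauchyPDFReal_def]
    have := Real.pi_pos
    simp only [NNReal.coe_mk, sub_zero]
    field_simp
    ring
  rw [heq]
  refine ⟨(ProbabilityTheory.integrable_cauchyPDFReal 0).const_mul _, ?_⟩
  rw [integral_const_mul, ProbabilityTheory.integral_cauchyPDFReal_eq_one 0 hne, mul_one]

lemma sq_mul_horseshoeKernel_le {τ l : ℝ} (hτ : 0 < τ) (hl : 0 < l) {θ : ℝ} (hθ : θ ≠ 0) :
    θ ^ 2 * horseshoeKernel τ θ l ≤ 8 * τ / Real.pi * (|θ| / (|θ| ^ 2 + l ^ 2)) := by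
  have hπ := Real.pi_pos
  set b := |θ| with hb
  have hb0 : 0 < b := abs_pos.2 hθ
  have hθb : θ ^ 2 = b ^ 2 := (sq_abs θ).symm
  have hexp : Real.exp (-(b ^ 2) / (2 * l ^ 2)) ≤
      8 * l ^ 4 / (8 * l ^ 4 + 4 * b ^ 2 * l ^ 2 + b ^ 4) := by
    have h := Real.quadratic_le_exp_of_nonneg (x := b ^ 2 / (2 * l ^ 2)) (by positivity)
    rw [neg_div, Real.exp_neg, inv_le_comm₀ (Real.exp_pos _) (by positivity)]
    refine le_trans (le_of_eq ?_) h
    field_simp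
    ring
  have hsqrt : l ≤ Real.sqrt (2 * Real.pi * l ^ 2) :=
    Real.le_sqrt_of_sq_le (by nlinarith [Real.pi_gt_three, sq_nonneg l])
  unfold horseshoeKernel
  rw [hθb]
  calc b ^ 2 * (Real.exp (-(b ^ 2) / (2 * l ^ 2)) / Real.sqrt (2 * Real.pi * l ^ 2) *
        (2 * τ / (Real.pi * (τ ^ 2 + l ^ 2))))
      ≤ b ^ 2 * (8 * l ^ 4 / (8 * l ^ 4 + 4 * b ^ 2 * l ^ 2 + b ^ 4) / l *
        (2 * τ / (Real.pi * l ^ 2))) := by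
        gcongr
        nlinarith [sq_nonneg τ]
    _ = 8 * τ / Real.pi * (2 * b ^ 2 * l / (8 * l ^ 4 + 4 * b ^ 2 * l ^ 2 + b ^ 4)) := by
        field_simp
    _ ≤ _ := by
        gcongr ?_ * ?_
        rw [div_le_div_iff₀ (by positivity) (by positivity)]
        have h1 : 2 * b * l ≤ b ^ 2 + l ^ 2 := by nlinarith [sq_nonneg (b - l)]
        have h2 : 2 * b * l * (b ^ 2 + l ^ 2) ≤ (b ^ 2 + l ^ 2) * (b ^ 2 + l ^ 2) := by gcongr
        have h3 : 2 * b * l * (b ^ 2 + l ^ 2) ≤ 8 * l ^ 4 + 4 * b ^ 2 * l ^ 2 + b ^ 4 := by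
          nlinarith [sq_nonneg (b * l), sq_nonneg (l ^ 2)]
        nlinarith [mul_le_mul_of_nonneg_left h3 hb0.le]

lemma integrableOn_horseshoeKernel {τ θ : ℝ} (hτ : 0 < τ) (hθ : θ ≠ 0) :
    IntegrableOn (horseshoeKernel τ θ) (Ioi 0) := by
  have hb := (((integrable_div_sq_add_sq (abs_pos.2 hθ)).1.const_mul
    (8 * τ / Real.pi)).const_mul (θ ^ 2)⁻¹).integrableOn (s := Ioi 0)
  refine Integrable.mono' hb
    ((measurable_horseshoeKernel τ).comp measurable_prodMk_left).aestronglyMeasurable ?_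
  filter_upwards [ae_restrict_mem measurableSet_Ioi] with l hl
  rw [Real.norm_of_nonneg (horseshoeKernel_nonneg hτ θ l), inv_mul_eq_div,
    le_div_iff₀ (by positivity), mul_comm]
  exact sq_mul_horseshoeKernel_le hτ hl hθ

lemma sq_mul_horseshoeDensity_le {τ : ℝ} (hτ : 0 < τ) (θ : ℝ) :
    θ ^ 2 * horseshoeDensity τ θ ≤ 8 * τ := by
  rcases eq_or_ne θ 0 with rfl | hθ
  · simpa using hτ.le
  have hint := integrable_div_sq_add_sq (abs_pos.2 hθ)
  have hpi := Real.pi_pos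
  rw [horseshoeDensity_eq, ← integral_const_mul]
  calc _ ≤ ∫ l in Ioi (0 : ℝ), 8 * τ / Real.pi * (|θ| / (|θ| ^ 2 + l ^ 2)) :=
        setIntegral_mono_on ((integrableOn_horseshoeKernel hτ hθ).const_mul _)
          (hint.1.const_mul _).integrableOn measurableSet_Ioi
          fun l hl => sq_mul_horseshoeKernel_le hτ hl hθ
    _ ≤ ∫ l : ℝ, 8 * τ / Real.pi * (|θ| / (|θ| ^ 2 + l ^ 2)) :=
        setIntegral_le_integral (hint.1.const_mul _) (ae_of_all _ fun l => by positivity)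
    _ = 8 * τ := by rw [integral_const_mul, hint.2]; field_simp

lemma le_horseshoeDensity {τ θ a : ℝ} (hτ : 0 < τ) (hθ : θ ≠ 0) (hτa : τ ≤ a) (hθa : |θ| ≤ a) :
    τ / (120 * a ^ 2) ≤ horseshoeDensity τ θ := by
  have ha : 0 < a := hτ.trans_le hτa
  have hint := integrableOn_horseshoeKernel hτ hθ
  have hsub : Icc a (2 * a) ⊆ Ioi 0 := fun l hl => ha.trans_le hl.1
  have hlow : ∀ l ∈ Icc a (2 * a), τ / (120 * a ^ 3) ≤ horseshoeKernel τ θ l := by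
    intro l hl
    have hl0 : 0 < l := hsub hl
    have hπ := Real.pi_pos
    have hexp : 1 / 2 ≤ Real.exp (-(θ ^ 2) / (2 * l ^ 2)) := by
      have h1 : θ ^ 2 ≤ l ^ 2 := sq_le_sq' (by linarith [(abs_le.1 hθa).1, hl.1])
        (by linarith [(abs_le.1 hθa).2, hl.1])
      have h2 : θ ^ 2 / (2 * l ^ 2) ≤ 1 / 2 := by
        rw [div_le_div_iff₀ (by positivity) (by norm_num)]; linarith
      have h3 := Real.add_one_le_exp (-(θ ^ 2) / (2 * l ^ 2))
      rw [neg_div] at h3 ⊢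
      linarith
    have hsqrt : Real.sqrt (2 * Real.pi * l ^ 2) ≤ 6 * a := by
      rw [Real.sqrt_le_left (by positivity)]
      nlinarith [hl.1, hl.2, Real.pi_lt_four, mul_le_mul hl.2 hl.2 hl0.le (by positivity)]
    have hden : Real.pi * (τ ^ 2 + l ^ 2) ≤ 4 * (5 * a ^ 2) := by
      gcongr
      · exact Real.pi_lt_four.le
      · nlinarith [hl.1, hl.2]
    have hs0 : 0 < Real.sqrt (2 * Real.pi * l ^ 2) := by positivity
    calc τ / (120 * a ^ 3) = (1 / 2) / (6 * a) * (2 * τ / (4 * (5 * a ^ 2))) := by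
          field_simp; norm_num
      _ ≤ _ := by unfold horseshoeKernel; gcongr
  calc τ / (120 * a ^ 2) = ∫ _ in Icc a (2 * a), τ / (120 * a ^ 3) := by
        rw [setIntegral_const, Real.volume_real_Icc_of_le (by linarith), smul_eq_mul]
        field_simp; norm_num
    _ ≤ ∫ l in Icc a (2 * a), horseshoeKernel τ θ l :=
        setIntegral_mono_on (integrableOn_const (by simp)) (hint.mono_set hsub)
          measurableSet_Icc hlow
    _ ≤ _ := setIntegral_mono_set hint (ae_of_all _ fun l => horseshoeKernel_nonneg hτ θ l)
        hsub.eventuallyLE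

/-- The horseshoe distribution with global parameter `τ`. -/
noncomputable def horseshoeMeasure (τ : ℝ) : Measure ℝ :=
  volume.withDensity fun θ => ENNReal.ofReal (horseshoeDensity τ θ)

lemma lintegral_horseshoeKernel {τ l : ℝ} (hl : 0 < l) :
    ∫⁻ θ, ENNReal.ofReal (horseshoeKernel τ θ l) =
      ENNReal.ofReal (2 / Real.pi * (τ / (τ ^ 2 + l ^ 2))) := by
  have hv : NNReal.mk (l ^ 2) (sq_nonneg l) ≠ 0 := fun h =>
    (pow_pos hl 2).ne' (congrArg NNReal.toReal h)
  have heq : ∀ θ, ENNReal.ofReal (horseshoeKernel τ θ l) =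
      ENNReal.ofReal (ProbabilityTheory.gaussianPDFReal 0 (.mk (l ^ 2) (sq_nonneg l)) θ) *
        ENNReal.ofReal (2 / Real.pi * (τ / (τ ^ 2 + l ^ 2))) := fun θ => by
    rw [← ENNReal.ofReal_mul (ProbabilityTheory.gaussianPDFReal_nonneg _ _ _)]
    congr 1
    simp only [horseshoeKernel, ProbabilityTheory.gaussianPDFReal, NNReal.coe_mk, sub_zero]
    rw [div_mul_div_comm 2, div_eq_inv_mul (Real.exp _)]
  simp_rw [heq]
  rw [lintegral_mul_const _ (by fun_prop),
    ProbabilityTheory.lintegral_gaussianPDFReal_eq_one 0 hv, one_mul]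

lemma horseshoeMeasure_univ_le {τ : ℝ} (hτ : 0 < τ) : horseshoeMeasure τ univ ≤ 2 := by
  have hπ := Real.pi_pos
  have hint := integrable_div_sq_add_sq hτ
  rw [horseshoeMeasure, withDensity_apply _ MeasurableSet.univ, setLIntegral_univ]
  calc ∫⁻ θ, ENNReal.ofReal (horseshoeDensity τ θ)
      ≤ ∫⁻ θ, ∫⁻ l in Ioi (0 : ℝ), ENNReal.ofReal (horseshoeKernel τ θ l) := by
        refine lintegral_mono fun θ => ?_
        rw [horseshoeDensity_eq, integral_eq_lintegral_of_nonneg_ae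
          (ae_of_all _ fun l => horseshoeKernel_nonneg hτ θ l)
          ((measurable_horseshoeKernel τ).comp measurable_prodMk_left).aestronglyMeasurable]
        exact ENNReal.ofReal_toReal_le
    _ = ∫⁻ l in Ioi (0 : ℝ), ∫⁻ θ, ENNReal.ofReal (horseshoeKernel τ θ l) :=
        lintegral_lintegral_swap (measurable_horseshoeKernel τ).ennreal_ofReal.aemeasurable
    _ = ∫⁻ l in Ioi (0 : ℝ), ENNReal.ofReal (2 / Real.pi * (τ / (τ ^ 2 + l ^ 2))) :=
        setLIntegral_congr_fun measurableSet_Ioi fun l hl => lintegral_horseshoeKernel hl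
    _ ≤ ∫⁻ l, ENNReal.ofReal (2 / Real.pi * (τ / (τ ^ 2 + l ^ 2))) :=
        setLIntegral_le_lintegral _ _
    _ = 2 := by
        rw [← ofReal_integral_eq_lintegral_ofReal (hint.1.const_mul _)
          (ae_of_all _ fun l => by positivity), integral_const_mul, hint.2,
          div_mul_cancel₀ _ hπ.ne']
        simp

lemma isFiniteMeasure_horseshoeMeasure {τ : ℝ} (hτ : 0 < τ) :
    IsFiniteMeasure (horseshoeMeasure τ) :=
  ⟨(horseshoeMeasure_univ_le hτ).trans_lt (by simp)⟩

lemma lintegral_horseshoeMeasure {τ : ℝ} {f : ℝ → ℝ≥0∞} (hf : Measurable f) :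
    ∫⁻ θ, f θ ∂(horseshoeMeasure τ) =
      ∫⁻ θ, ENNReal.ofReal (horseshoeDensity τ θ) * f θ :=
  lintegral_withDensity_eq_lintegral_mul _ (measurable_horseshoeDensity τ).ennreal_ofReal hf

lemma lintegral_sq_mul_horseshoeMeasure_le {τ : ℝ} (hτ : 0 < τ) {f : ℝ → ℝ≥0∞}
    (hf : Measurable f) :
    ∫⁻ θ, ENNReal.ofReal (θ ^ 2) * f θ ∂(horseshoeMeasure τ) ≤
      ENNReal.ofReal (8 * τ) * ∫⁻ θ, f θ := by
  rw [lintegral_horseshoeMeasure (by fun_prop), ← lintegral_const_mul _ hf]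
  refine lintegral_mono fun θ => ?_
  rw [← mul_assoc, mul_comm (ENNReal.ofReal (horseshoeDensity τ θ)),
    ← ENNReal.ofReal_mul (sq_nonneg θ)]
  exact mul_le_mul' (ENNReal.ofReal_le_ofReal (sq_mul_horseshoeDensity_le hτ θ)) le_rfl

lemma one_add_sq_mul_sq_mul_gaussDensity_le (u : ℝ) :
    (1 + u ^ 2) * u ^ 2 * gaussDensity u ≤ 32 * Real.exp (-(u ^ 2) / 4) := by
  have h := Real.quadratic_le_exp_of_nonneg (x := u ^ 2 / 4) (by positivity)
  have hsplit : Real.exp (-(u ^ 2) / 2) = Real.exp (-(u ^ 2) / 4) * (Real.exp (u ^ 2 / 4))⁻¹ := by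
    rw [← Real.exp_neg, ← Real.exp_add]
    ring_nf
  calc _ ≤ (1 + u ^ 2) * u ^ 2 * Real.exp (-(u ^ 2) / 2) := by
        gcongr
        exact gaussDensity_le_exp u
    _ = (1 + u ^ 2) * u ^ 2 / Real.exp (u ^ 2 / 4) * Real.exp (-(u ^ 2) / 4) := by
        rw [hsplit]; ring
    _ ≤ _ := by
        gcongr
        rw [div_le_iff₀ (Real.exp_pos _)]
        nlinarith [sq_nonneg u]

lemma lintegral_exp_neg_sq_div_four_le (m : ℝ) :
    ∫⁻ x, ENNReal.ofReal (Real.exp (-((x - m) ^ 2) / 4)) ≤ 4 := by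
  have heq : ∀ x : ℝ, Real.exp (-(x ^ 2) / 4) = Real.exp (-(1 / 4) * x ^ 2) := fun x => by
    ring_nf
  rw [lintegral_sub_right_eq_self fun x => ENNReal.ofReal (Real.exp (-(x ^ 2) / 4))]
  simp_rw [heq]
  rw [← ofReal_integral_eq_lintegral_ofReal (integrable_exp_neg_mul_sq (by norm_num))
    (ae_of_all _ fun x => (Real.exp_pos _).le), integral_gaussian]
  rw [show (4 : ℝ≥0∞) = ENNReal.ofReal 4 by simp]
  refine ENNReal.ofReal_le_ofReal ?_
  rw [Real.sqrt_le_left (by norm_num)]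
  linarith [Real.pi_lt_four]

lemma ofReal_mul_volume_le_coordMarginal {τ y k : ℝ} {S : Set ℝ} (hS : MeasurableSet S)
    (h : ∀ θ ∈ S, k ≤ horseshoeDensity τ θ * gaussDensity (y - θ)) :
    ENNReal.ofReal k * volume S ≤ coordMarginal (horseshoeMeasure τ) y := by
  rw [coordMarginal, lintegral_horseshoeMeasure (by fun_prop), ← setLIntegral_const]
  refine (setLIntegral_mono' hS fun θ hθ => ?_).trans (setLIntegral_le_lintegral S _)
  rw [← ENNReal.ofReal_mul' (gaussDensity_pos _).le]
  exact ENNReal.ofReal_le_ofReal (h θ hθ)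

lemma ofReal_div_one_add_sq_le_coordMarginal {τ : ℝ} (hτ : 0 < τ) (hτ1 : τ ≤ 1) (y : ℝ) :
    ENNReal.ofReal (τ / (2160 * (1 + y ^ 2))) ≤ coordMarginal (horseshoeMeasure τ) y := by
  have key : ∀ θ, θ ≠ 0 → |y - θ| ≤ 1 →
      τ / (2160 * (1 + y ^ 2)) ≤ horseshoeDensity τ θ * gaussDensity (y - θ) := by
    intro θ hθ hyθ
    have hu : (y - θ) ^ 2 ≤ 1 := by rw [← sq_abs]; nlinarith [abs_nonneg (y - θ)]
    have hφ : 1 / 6 ≤ gaussDensity (y - θ) := by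
      have h1 : 1 / 2 ≤ Real.exp (-((y - θ) ^ 2) / 2) := by
        linarith [Real.add_one_le_exp (-((y - θ) ^ 2) / 2)]
      have h2 : Real.sqrt (2 * Real.pi) ≤ 3 := by
        rw [Real.sqrt_le_left (by norm_num)]
        linarith [Real.pi_lt_four]
      calc (1 / 6 : ℝ) = (1 / 2) / 3 := by norm_num
        _ ≤ _ := by unfold gaussDensity; gcongr
    have hp := le_horseshoeDensity (a := Real.sqrt (1 + θ ^ 2)) hτ hθ
      (hτ1.trans (Real.one_le_sqrt.2 (by nlinarith [sq_nonneg θ])))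
      (Real.abs_le_sqrt (by linarith))
    rw [Real.sq_sqrt (by positivity)] at hp
    have hθy : 1 + θ ^ 2 ≤ 3 * (1 + y ^ 2) := by nlinarith [sq_nonneg (2 * y - θ)]
    calc τ / (2160 * (1 + y ^ 2)) = τ / (120 * (3 * (1 + y ^ 2))) * (1 / 6) := by
          field_simp; norm_num
      _ ≤ τ / (120 * (1 + θ ^ 2)) * (1 / 6) := by gcongr
      _ ≤ _ := by gcongr; exact le_trans (by positivity) hp
  rcases le_total 0 y with hy | hy
  · refine le_trans (le_of_eq ?_) (ofReal_mul_volume_le_coordMarginal (S := Ioo y (y + 1))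
      measurableSet_Ioo fun θ hθ => key θ (hy.trans_lt hθ.1).ne' ?_)
    · simp
    · rw [abs_le]; constructor <;> linarith [hθ.1, hθ.2]
  · refine le_trans (le_of_eq ?_) (ofReal_mul_volume_le_coordMarginal (S := Ioo (y - 1) y)
      measurableSet_Ioo fun θ hθ => key θ (hθ.2.trans_le hy).ne ?_)
    · simp
    · rw [abs_le]; constructor <;> linarith [hθ.1, hθ.2]

lemma ofReal_gaussDensity_le_coordMarginal {τ : ℝ} (hτ : 0 < τ) (hτ1 : τ ≤ 1) (y : ℝ) :
    ENNReal.ofReal (gaussDensity y) ≤ 240 * coordMarginal (horseshoeMeasure τ) y := by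
  have key : ∀ θ, θ ≠ 0 → |θ| ≤ τ → 0 ≤ y * θ →
      gaussDensity y / (240 * τ) ≤ horseshoeDensity τ θ * gaussDensity (y - θ) := by
    intro θ hθ hθτ hyθ
    have hφ : gaussDensity y / 2 ≤ gaussDensity (y - θ) := by
      have hθ1 : θ ^ 2 ≤ 1 := by rw [← sq_abs]; nlinarith [abs_nonneg θ]
      have h1 : 1 / 2 ≤ Real.exp (-(1 / 2)) := by linarith [Real.add_one_le_exp (-(1 / 2 : ℝ))]
      have h2 : Real.exp (-(y ^ 2) / 2) / 2 ≤ Real.exp (-((y - θ) ^ 2) / 2) :=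
        calc Real.exp (-(y ^ 2) / 2) / 2 ≤ Real.exp (-(y ^ 2) / 2) * Real.exp (-(1 / 2)) := by
              rw [div_eq_mul_one_div]; gcongr
          _ ≤ _ := by
              rw [← Real.exp_add]
              exact Real.exp_le_exp.2 (by nlinarith)
      unfold gaussDensity
      rw [div_right_comm]
      gcongr
    have hp := le_horseshoeDensity hτ hθ le_rfl hθτ
    calc gaussDensity y / (240 * τ) = τ / (120 * τ ^ 2) * (gaussDensity y / 2) := by
          field_simp; ring
      _ ≤ _ := by
          have := (gaussDensity_pos y).le
          gcongr
          exact le_trans (by positivity) hp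
  have hvol : ENNReal.ofReal (gaussDensity y) =
      240 * (ENNReal.ofReal (gaussDensity y / (240 * τ)) * ENNReal.ofReal τ) := by
    rw [← ENNReal.ofReal_mul' hτ.le, show (240 : ℝ≥0∞) = ENNReal.ofReal 240 by simp,
      ← ENNReal.ofReal_mul (by norm_num)]
    congr 1
    field_simp
  rw [hvol]
  gcongr
  rcases le_total 0 y with hy | hy
  · refine le_trans (le_of_eq ?_) (ofReal_mul_volume_le_coordMarginal (S := Ioo 0 τ)
      measurableSet_Ioo fun θ hθ => key θ hθ.1.ne' ?_ (mul_nonneg hy hθ.1.le))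
    · simp
    · rw [abs_le]; constructor <;> linarith [hθ.1, hθ.2]
  · refine le_trans (le_of_eq ?_) (ofReal_mul_volume_le_coordMarginal (S := Ioo (-τ) 0)
      measurableSet_Ioo fun θ hθ => key θ hθ.2.ne ?_ (mul_nonneg_of_nonpos_of_nonpos hy hθ.2.le))
    · simp
    · rw [abs_le]; constructor <;> linarith [hθ.1, hθ.2]

lemma coordMarginal_horseshoeMeasure_ne_zero {τ : ℝ} (hτ : 0 < τ) (hτ1 : τ ≤ 1) (y : ℝ) :
    coordMarginal (horseshoeMeasure τ) y ≠ 0 := fun h => by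
  have := ofReal_gaussDensity_le_coordMarginal hτ hτ1 y
  rw [h, mul_zero, nonpos_iff_eq_zero, ENNReal.ofReal_eq_zero] at this
  exact this.not_gt (gaussDensity_pos y)

/-- The posterior second moment about the observation is of order `L` when the global parameter
is `exp (-L)`, uniformly in the observation. -/
lemma coordSqLoss_self_le {L : ℝ} (hL : 1 ≤ L) (y : ℝ) :
    coordSqLoss (horseshoeMeasure (Real.exp (-L))) y y ≤
      ENNReal.ofReal (5000000 * L) * coordMarginal (horseshoeMeasure (Real.exp (-L))) y := by
  set τ := Real.exp (-L) with hτL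
  have hτ : 0 < τ := Real.exp_pos _
  have hτ1 : τ ≤ 1 := Real.exp_le_one_iff.2 (by linarith)
  have hy : 0 < 1 + y ^ 2 := by positivity
  have hpt : ∀ θ, (θ - y) ^ 2 * gaussDensity (y - θ) ≤ 4 * L * gaussDensity (y - θ) +
      64 / (1 + y ^ 2) * (τ + θ ^ 2 * Real.exp (-((θ - y) ^ 2) / 4)) := by
    intro θ
    rw [gaussDensity_sub_comm y θ]
    set u := θ - y with hu
    have hφ := gaussDensity_pos u
    have he := Real.exp_pos (-(u ^ 2) / 4)
    rcases le_total (u ^ 2) (4 * L) with h | h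
    · have : 0 ≤ 64 / (1 + y ^ 2) * (τ + θ ^ 2 * Real.exp (-(u ^ 2) / 4)) := by positivity
      nlinarith [mul_le_mul_of_nonneg_right h hφ.le]
    · have h1 : Real.exp (-(u ^ 2) / 4) ≤ τ := Real.exp_le_exp.2 (by linarith)
      have h2 : 1 + y ^ 2 ≤ 2 * (1 + u ^ 2) * (1 + θ ^ 2) := by
        have : y = θ - u := by rw [hu]; ring
        rw [this]
        nlinarith [sq_nonneg (θ + u), sq_nonneg (u * θ)]
      have h3 := one_add_sq_mul_sq_mul_gaussDensity_le u
      have h4 : u ^ 2 * gaussDensity u ≤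
          64 / (1 + y ^ 2) * (τ + θ ^ 2 * Real.exp (-(u ^ 2) / 4)) := by
        rw [div_mul_eq_mul_div, le_div_iff₀ hy]
        calc u ^ 2 * gaussDensity u * (1 + y ^ 2)
            ≤ u ^ 2 * gaussDensity u * (2 * (1 + u ^ 2) * (1 + θ ^ 2)) := by gcongr
          _ = 2 * (1 + θ ^ 2) * ((1 + u ^ 2) * u ^ 2 * gaussDensity u) := by ring
          _ ≤ 2 * (1 + θ ^ 2) * (32 * Real.exp (-(u ^ 2) / 4)) := by gcongr
          _ ≤ _ := by nlinarith
      have : 0 ≤ 4 * L * gaussDensity u := by positivity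
      linarith
  have hpt' : ∀ θ, ENNReal.ofReal ((θ - y) ^ 2) * ENNReal.ofReal (gaussDensity (y - θ)) ≤
      ENNReal.ofReal (4 * L) * ENNReal.ofReal (gaussDensity (y - θ)) +
        ENNReal.ofReal (64 / (1 + y ^ 2)) * (ENNReal.ofReal τ +
          ENNReal.ofReal (θ ^ 2) * ENNReal.ofReal (Real.exp (-((θ - y) ^ 2) / 4))) := by
    intro θ
    have hφ := (gaussDensity_pos (y - θ)).le
    rw [← ENNReal.ofReal_mul (sq_nonneg _), ← ENNReal.ofReal_mul (by positivity),
      ← ENNReal.ofReal_mul (sq_nonneg _), ← ENNReal.ofReal_add hτ.le (by positivity),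
      ← ENNReal.ofReal_mul (by positivity), ← ENNReal.ofReal_add (by positivity) (by positivity)]
    exact ENNReal.ofReal_le_ofReal (hpt θ)
  have hrest : ENNReal.ofReal (64 / (1 + y ^ 2)) * (ENNReal.ofReal τ * 2 +
      ENNReal.ofReal (8 * τ) * 4) ≤
        ENNReal.ofReal 4900000 * coordMarginal (horseshoeMeasure τ) y := by
    refine le_trans ?_ (mul_le_mul' le_rfl (ofReal_div_one_add_sq_le_coordMarginal hτ hτ1 y))
    rw [show (2 : ℝ≥0∞) = ENNReal.ofReal 2 by simp, show (4 : ℝ≥0∞) = ENNReal.ofReal 4 by simp,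
      ← ENNReal.ofReal_mul hτ.le, ← ENNReal.ofReal_mul (by positivity),
      ← ENNReal.ofReal_add (by positivity) (by positivity), ← ENNReal.ofReal_mul (by positivity),
      ← ENNReal.ofReal_mul (by positivity)]
    refine ENNReal.ofReal_le_ofReal ?_
    rw [div_mul_eq_mul_div, ← mul_div_assoc, div_le_div_iff₀ hy (by positivity)]
    nlinarith [mul_pos hτ hy]
  calc coordSqLoss (horseshoeMeasure τ) y y
      ≤ ∫⁻ θ, (ENNReal.ofReal (4 * L) * ENNReal.ofReal (gaussDensity (y - θ)) +
        ENNReal.ofReal (64 / (1 + y ^ 2)) * (ENNReal.ofReal τ + ENNReal.ofReal (θ ^ 2) *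
          ENNReal.ofReal (Real.exp (-((θ - y) ^ 2) / 4)))) ∂(horseshoeMeasure τ) :=
        lintegral_mono hpt'
    _ = ENNReal.ofReal (4 * L) * coordMarginal (horseshoeMeasure τ) y +
        ENNReal.ofReal (64 / (1 + y ^ 2)) * (ENNReal.ofReal τ * horseshoeMeasure τ univ +
          ∫⁻ θ, ENNReal.ofReal (θ ^ 2) * ENNReal.ofReal (Real.exp (-((θ - y) ^ 2) / 4))
            ∂(horseshoeMeasure τ)) := by
        rw [lintegral_add_left (by fun_prop), lintegral_const_mul _ (by fun_prop),
          lintegral_const_mul _ (by fun_prop), lintegral_add_left (by fun_prop),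
          lintegral_const, coordMarginal]
    _ ≤ ENNReal.ofReal (4 * L) * coordMarginal (horseshoeMeasure τ) y +
        ENNReal.ofReal (64 / (1 + y ^ 2)) * (ENNReal.ofReal τ * 2 +
          ENNReal.ofReal (8 * τ) * 4) := by
        gcongr
        · exact horseshoeMeasure_univ_le hτ
        · exact (lintegral_sq_mul_horseshoeMeasure_le hτ (by fun_prop)).trans
            (mul_le_mul' le_rfl (lintegral_exp_neg_sq_div_four_le y))
    _ ≤ ENNReal.ofReal (4 * L) * coordMarginal (horseshoeMeasure τ) y +
        ENNReal.ofReal 4900000 * coordMarginal (horseshoeMeasure τ) y := by gcongr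
    _ ≤ _ := by
        rw [← add_mul, ← ENNReal.ofReal_add (by positivity) (by norm_num)]
        gcongr
        linarith

lemma coordSqLoss_div_coordMarginal_le {L : ℝ} (hL : 1 ≤ L) (t y : ℝ) :
    coordSqLoss (horseshoeMeasure (Real.exp (-L))) t y /
        coordMarginal (horseshoeMeasure (Real.exp (-L))) y ≤
      ENNReal.ofReal (10000000 * L + 2 * (y - t) ^ 2) := by
  refine ENNReal.div_le_of_le_mul ?_
  set μ := horseshoeMeasure (Real.exp (-L))
  calc coordSqLoss μ t y
      ≤ ∫⁻ θ, (2 * (ENNReal.ofReal ((θ - y) ^ 2) * ENNReal.ofReal (gaussDensity (y - θ))) +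
          ENNReal.ofReal (2 * (y - t) ^ 2) * ENNReal.ofReal (gaussDensity (y - θ))) ∂μ := by
        refine lintegral_mono fun θ => ?_
        rw [← mul_assoc, ← add_mul, show (2 : ℝ≥0∞) = ENNReal.ofReal 2 by simp,
          ← ENNReal.ofReal_mul (p := 2) (by norm_num), ← ENNReal.ofReal_add (by positivity) (by positivity)]
        gcongr
        nlinarith [sq_nonneg ((θ - y) - (y - t))]
    _ = 2 * coordSqLoss μ y y + ENNReal.ofReal (2 * (y - t) ^ 2) * coordMarginal μ y := by
        rw [lintegral_add_left (by fun_prop), lintegral_const_mul _ (by fun_prop),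
          lintegral_const_mul _ (by fun_prop), coordMarginal, coordSqLoss]
    _ ≤ 2 * (ENNReal.ofReal (5000000 * L) * coordMarginal μ y) +
          ENNReal.ofReal (2 * (y - t) ^ 2) * coordMarginal μ y := by
        gcongr
        exact coordSqLoss_self_le hL y
    _ = _ := by
        rw [← mul_assoc, ← add_mul, show (2 : ℝ≥0∞) = ENNReal.ofReal 2 by simp,
          ← ENNReal.ofReal_mul (p := 2) (by norm_num), ← ENNReal.ofReal_add (by positivity) (by positivity)]
        ring_nf

lemma coordRisk_le {L : ℝ} (hL : 1 ≤ L) (t : ℝ) :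
    coordRisk (horseshoeMeasure (Real.exp (-L))) t ≤ ENNReal.ofReal (20000000 * L) := by
  calc coordRisk (horseshoeMeasure (Real.exp (-L))) t
      ≤ ∫⁻ y, (ENNReal.ofReal (10000000 * L) * ENNReal.ofReal (gaussDensity (y - t)) +
          ENNReal.ofReal 64 * ENNReal.ofReal (Real.exp (-((y - t) ^ 2) / 4))) := by
        refine lintegral_mono fun y => ?_
        have hφ := (gaussDensity_pos (y - t)).le
        refine (mul_le_mul' (coordSqLoss_div_coordMarginal_le hL t y) le_rfl).trans ?_
        rw [← ENNReal.ofReal_mul (by positivity), ← ENNReal.ofReal_mul (by positivity),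
          ← ENNReal.ofReal_mul (by norm_num), ← ENNReal.ofReal_add (by positivity) (by positivity)]
        refine ENNReal.ofReal_le_ofReal ?_
        have h := one_add_sq_mul_sq_mul_gaussDensity_le (y - t)
        have h' : 0 ≤ (y - t) ^ 2 * (y - t) ^ 2 * gaussDensity (y - t) := by positivity
        nlinarith
    _ ≤ ENNReal.ofReal (10000000 * L) * 1 + ENNReal.ofReal 64 * 4 := by
        rw [lintegral_add_left (by fun_prop), lintegral_const_mul _ (by fun_prop),
          lintegral_const_mul _ (by fun_prop), lintegral_gaussDensity_sub]
        gcongr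
        exact lintegral_exp_neg_sq_div_four_le t
    _ ≤ _ := by
        rw [mul_one, show (4 : ℝ≥0∞) = ENNReal.ofReal 4 by simp,
          ← ENNReal.ofReal_mul (by norm_num), ← ENNReal.ofReal_add (by positivity) (by norm_num)]
        exact ENNReal.ofReal_le_ofReal (by linarith)

lemma hasDerivAt_gaussDensity (y : ℝ) : HasDerivAt gaussDensity (-y * gaussDensity y) y := by
  have h := ((((hasDerivAt_id y).pow 2).neg.div_const 2).exp).div_const (Real.sqrt (2 * Real.pi))
  refine h.congr_deriv ?_
  simp [gaussDensity]
  ring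

lemma tendsto_mul_gaussDensity : Tendsto (fun y => y * gaussDensity y) atTop (nhds 0) := by
  have h2 : Tendsto (fun y : ℝ => 2 / y) atTop (nhds 0) := tendsto_const_nhds.div_atTop tendsto_id
  refine tendsto_of_tendsto_of_tendsto_of_le_of_le' tendsto_const_nhds h2 ?_ ?_
  · filter_upwards [eventually_ge_atTop 0] with y hy
    exact mul_nonneg hy (gaussDensity_pos y).le
  · filter_upwards [eventually_gt_atTop 0] with y hy
    have h1 : Real.exp (-(y ^ 2) / 2) ≤ 2 / y ^ 2 := by
      have h := Real.add_one_le_exp (y ^ 2 / 2)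
      rw [neg_div, Real.exp_neg, inv_le_comm₀ (Real.exp_pos _) (by positivity), inv_div]
      linarith
    calc y * gaussDensity y ≤ y * (2 / y ^ 2) := by
          gcongr
          exact (gaussDensity_le_exp y).trans h1
      _ = 2 / y := by field_simp

lemma setLIntegral_Ioi_sq_mul_gaussDensity_le {z : ℝ} (hz : 0 ≤ z) (hz2 : 2 ≤ z ^ 2) :
    ∫⁻ y in Ioi z, ENNReal.ofReal (y ^ 2 * gaussDensity y) ≤
      ENNReal.ofReal (2 * z * gaussDensity z) := by
  have hsq : ∀ y ∈ Ioi z, 2 ≤ y ^ 2 := fun y hy =>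
    hz2.trans (pow_le_pow_left₀ hz (le_of_lt hy) 2)
  have hderiv : ∀ y ∈ Ici z, HasDerivAt (fun y => -2 * (y * gaussDensity y))
      (2 * (y ^ 2 - 1) * gaussDensity y) y := fun y _ => by
    refine (((hasDerivAt_id y).mul (hasDerivAt_gaussDensity y)).const_mul (-2)).congr_deriv ?_
    simp
    ring
  have hpos : ∀ y ∈ Ioi z, 0 ≤ 2 * (y ^ 2 - 1) * gaussDensity y := fun y hy =>
    mul_nonneg (by linarith [hsq y hy]) (gaussDensity_pos y).le
  have hlim : Tendsto (fun y => -2 * (y * gaussDensity y)) atTop (nhds 0) := by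
    simpa using tendsto_mul_gaussDensity.const_mul (-2)
  calc _ ≤ ∫⁻ y in Ioi z, ENNReal.ofReal (2 * (y ^ 2 - 1) * gaussDensity y) := by
        refine setLIntegral_mono' measurableSet_Ioi fun y hy => ENNReal.ofReal_le_ofReal ?_
        exact mul_le_mul_of_nonneg_right (by linarith [hsq y hy]) (gaussDensity_pos y).le
    _ = ENNReal.ofReal (2 * z * gaussDensity z) := by
        rw [← ofReal_integral_eq_lintegral_ofReal
            (integrableOn_Ioi_deriv_of_nonneg' hderiv hpos hlim)
            ((ae_restrict_mem measurableSet_Ioi).mono hpos),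
          integral_Ioi_of_hasDerivAt_of_nonneg' hderiv hpos hlim]
        ring_nf

lemma setLIntegral_compl_Icc_sq_mul_gaussDensity_le {z : ℝ} (hz : 0 ≤ z) (hz2 : 2 ≤ z ^ 2) :
    ∫⁻ y in (Icc (-z) z)ᶜ, ENNReal.ofReal (y ^ 2 * gaussDensity y) ≤
      ENNReal.ofReal (4 * z * gaussDensity z) := by
  have hφ := (gaussDensity_pos z).le
  have hneg : ∫⁻ y in Iio (-z), ENNReal.ofReal (y ^ 2 * gaussDensity y) =
      ∫⁻ y in Ioi z, ENNReal.ofReal (y ^ 2 * gaussDensity y) := by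
    rw [← (Measure.measurePreserving_neg (volume : Measure ℝ)).setLIntegral_comp_preimage_emb
      (Homeomorph.neg ℝ).measurableEmbedding]
    simp [gaussDensity_neg]
  have hset : (Icc (-z) z)ᶜ = Iio (-z) ∪ Ioi z := by
    ext y; simp only [mem_compl_iff, mem_Icc, mem_union, mem_Iio, mem_Ioi]; grind
  rw [hset]
  refine (lintegral_union_le _ _ _).trans ?_
  rw [hneg, show 4 * z * gaussDensity z = 2 * z * gaussDensity z + 2 * z * gaussDensity z by ring,
    ENNReal.ofReal_add (by positivity) (by positivity)]
  gcongr <;> exact setLIntegral_Ioi_sq_mul_gaussDensity_le hz hz2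

lemma coordSqLoss_zero_le {τ : ℝ} (hτ : 0 < τ) (y : ℝ) :
    coordSqLoss (horseshoeMeasure τ) 0 y ≤ ENNReal.ofReal (8 * τ) := by
  simp only [coordSqLoss, sub_zero]
  refine (lintegral_sq_mul_horseshoeMeasure_le hτ (by fun_prop)).trans (le_of_eq ?_)
  simp_rw [gaussDensity_sub_comm y]
  rw [lintegral_gaussDensity_sub, mul_one]

lemma coordRisk_zero_le {L : ℝ} (hL : 1 ≤ L) :
    coordRisk (horseshoeMeasure (Real.exp (-L))) 0 ≤
      ENNReal.ofReal (30000000 * (Real.exp (-L) * Real.sqrt (2 * L))) := by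
  set τ := Real.exp (-L) with hτL
  set z := Real.sqrt (2 * L) with hz
  have hτ : 0 < τ := Real.exp_pos _
  have hτ1 : τ ≤ 1 := Real.exp_le_one_iff.2 (by linarith)
  have hz0 : 0 ≤ z := Real.sqrt_nonneg _
  have hzsq : z ^ 2 = 2 * L := Real.sq_sqrt (by linarith)
  have hφz : gaussDensity z ≤ τ := by
    refine (gaussDensity_le_exp z).trans (le_of_eq ?_)
    rw [hzsq, hτL]
    ring_nf
  have hin : ∫⁻ y in Icc (-z) z, coordSqLoss (horseshoeMeasure τ) 0 y /
      coordMarginal (horseshoeMeasure τ) y * ENNReal.ofReal (gaussDensity (y - 0)) ≤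
        ENNReal.ofReal (3840 * (τ * z)) := by
    have : IsFiniteMeasure (horseshoeMeasure τ) := isFiniteMeasure_horseshoeMeasure hτ
    calc _ ≤ ∫⁻ _ in Icc (-z) z, 240 * ENNReal.ofReal (8 * τ) := by
          refine setLIntegral_mono' measurableSet_Icc fun y _ => ?_
          rw [sub_zero]
          refine (mul_le_mul' le_rfl (ofReal_gaussDensity_le_coordMarginal hτ hτ1 y)).trans ?_
          rw [mul_left_comm, ENNReal.div_mul_cancel
            (coordMarginal_horseshoeMeasure_ne_zero hτ hτ1 y) (coordMarginal_ne_top _ y)]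
          gcongr
          exact coordSqLoss_zero_le hτ y
      _ = _ := by
          rw [setLIntegral_const, Real.volume_Icc, show (240 : ℝ≥0∞) = ENNReal.ofReal 240 by simp,
            ← ENNReal.ofReal_mul (by norm_num), ← ENNReal.ofReal_mul (by positivity)]
          ring_nf
  have hout : ∫⁻ y in (Icc (-z) z)ᶜ, coordSqLoss (horseshoeMeasure τ) 0 y /
      coordMarginal (horseshoeMeasure τ) y * ENNReal.ofReal (gaussDensity (y - 0)) ≤
        ENNReal.ofReal (20000008 * (τ * z)) := by
    calc _ ≤ ∫⁻ y in (Icc (-z) z)ᶜ, ENNReal.ofReal 5000002 *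
          ENNReal.ofReal (y ^ 2 * gaussDensity y) := by
          refine setLIntegral_mono' measurableSet_Icc.compl fun y hy => ?_
          refine (mul_le_mul' (coordSqLoss_div_coordMarginal_le hL 0 y) le_rfl).trans ?_
          rw [sub_zero, ← ENNReal.ofReal_mul (by positivity), ← ENNReal.ofReal_mul (by norm_num)]
          refine ENNReal.ofReal_le_ofReal ?_
          have hy2 : 2 * L ≤ y ^ 2 := by
            rw [← hzsq, ← sq_abs y]
            refine pow_le_pow_left₀ hz0 ?_ 2
            by_contra! h
            exact hy (abs_le.1 h.le)
          rw [← mul_assoc]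
          exact mul_le_mul_of_nonneg_right (by linarith) (gaussDensity_pos y).le
      _ ≤ ENNReal.ofReal 5000002 * ENNReal.ofReal (4 * z * gaussDensity z) := by
          rw [lintegral_const_mul _ (by fun_prop)]
          gcongr
          exact setLIntegral_compl_Icc_sq_mul_gaussDensity_le hz0 (by linarith)
      _ ≤ _ := by
          rw [← ENNReal.ofReal_mul (by norm_num)]
          refine ENNReal.ofReal_le_ofReal ?_
          nlinarith [mul_le_mul_of_nonneg_left hφz hz0]
  rw [coordRisk, ← lintegral_add_compl _ (measurableSet_Icc (a := -z) (b := z))]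
  refine (add_le_add hin hout).trans ?_
  rw [← ENNReal.ofReal_add (by positivity) (by positivity)]
  refine ENNReal.ofReal_le_ofReal ?_
  nlinarith [mul_nonneg hτ.le hz0]

lemma sum_coordRisk_le {n s : ℕ} {L : ℝ} (hL : 1 ≤ L) {θ0 : Fin n → ℝ}
    (hθ0 : θ0 ∈ nearlyBlack n s) :
    ∑ i, coordRisk (horseshoeMeasure (Real.exp (-L))) (θ0 i) ≤
      ENNReal.ofReal (n * (30000000 * (Real.exp (-L) * Real.sqrt (2 * L))) +
        s * (20000000 * L)) := by
  classical
  set a := 30000000 * (Real.exp (-L) * Real.sqrt (2 * L))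
  have ha : 0 ≤ a := by positivity
  have hcard : ((Finset.univ.filter fun i => θ0 i ≠ 0).card : ℝ) ≤ s := by
    have h : Set.ncard {i | θ0 i ≠ 0} ≤ s := hθ0
    rw [Set.ncard_eq_toFinset_card'] at h
    simpa using h
  calc ∑ i, coordRisk (horseshoeMeasure (Real.exp (-L))) (θ0 i)
      ≤ ∑ i, ENNReal.ofReal (a + if θ0 i ≠ 0 then 20000000 * L else 0) := by
        refine Finset.sum_le_sum fun i _ => ?_
        by_cases h : θ0 i = 0
        · rw [h, if_neg (not_not.2 rfl), add_zero]
          exact coordRisk_zero_le hL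
        · refine (coordRisk_le hL _).trans (ENNReal.ofReal_le_ofReal ?_)
          simpa [h] using ha
    _ = ENNReal.ofReal (n * a +
          (Finset.univ.filter fun i => θ0 i ≠ 0).card * (20000000 * L)) := by
        rw [← ENNReal.ofReal_sum_of_nonneg fun i _ => by split_ifs <;> positivity,
          Finset.sum_add_distrib, ← Finset.sum_filter]
        simp
    _ ≤ _ := by
        refine ENNReal.ofReal_le_ofReal ?_
        gcongr

/-- Elementary bounds for the global parameter `τ = (s / n) √(log (n / s))`. -/
lemma global_param_bounds {n s : ℝ} (hs : 1 ≤ s) (hn : 0 < n) (hsn : s / n ≤ Real.exp (-2)) :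
    ∃ L, 1 ≤ L ∧ s / n * Real.sqrt (Real.log (n / s)) = Real.exp (-L) ∧ L ≤ Real.log n ∧
      n * (Real.exp (-L) * Real.sqrt (2 * L)) ≤ 2 * (s * Real.log n) := by
  have hs0 : 0 < s := by linarith
  set x := s / n with hx
  have hx0 : 0 < x := by positivity
  have hinv : n / s = x⁻¹ := by rw [hx, inv_div]
  set l := Real.log (n / s) with hl
  have hlx : l = -Real.log x := by rw [hl, hinv, Real.log_inv]
  have hl2 : 2 ≤ l := by
    have := (Real.log_le_iff_le_exp hx0).2 hsn
    linarith
  have hln : l ≤ Real.log n := Real.log_le_log (by positivity) (div_le_self hn.le hs)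
  have hsq1 : 1 ≤ Real.sqrt l := Real.one_le_sqrt.2 (by linarith)
  set τ := x * Real.sqrt l with hτ
  have hτ0 : 0 < τ := by positivity
  have hlogτ : Real.log τ = Real.log x + Real.log l / 2 := by
    rw [hτ, Real.log_mul hx0.ne' (by positivity), Real.log_sqrt (by linarith)]
  have hlogl : Real.log l ≤ l - 1 := Real.log_le_sub_one_of_pos (by linarith)
  have hlogl0 : 0 ≤ Real.log l := Real.log_nonneg (by linarith)
  have hLn : -Real.log τ ≤ Real.log n := by linarith
  refine ⟨-Real.log τ, by linarith, by rw [neg_neg, Real.exp_log hτ0], hLn, ?_⟩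
  rw [neg_neg, Real.exp_log hτ0]
  have hlogn : 0 ≤ Real.log n := by linarith
  have h1 : Real.sqrt l ≤ Real.sqrt (Real.log n) := Real.sqrt_le_sqrt hln
  have h2 : Real.sqrt (2 * -Real.log τ) ≤ 2 * Real.sqrt (Real.log n) := by
    rw [Real.sqrt_le_left (by positivity), mul_pow, Real.sq_sqrt hlogn]
    linarith
  calc n * (τ * Real.sqrt (2 * -Real.log τ))
      = s * (Real.sqrt l * Real.sqrt (2 * -Real.log τ)) := by
        rw [hτ, hx]; field_simp
    _ ≤ s * (Real.sqrt (Real.log n) * (2 * Real.sqrt (Real.log n))) := by gcongr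
    _ = 2 * (s * Real.log n) := by
        linear_combination 2 * s * Real.mul_self_sqrt hlogn

/-- In the normal sequence model with i.i.d. horseshoe coordinates with global parameter
`τ = (sₙ/n)√(log(n/sₙ))`, where `sₙ → ∞` and `sₙ/n → 0`, the posterior contracts at the
rate `√(sₙ log n)`: for every `Mₙ → ∞`,
`sup_{θ₀ ∈ ℓ₀[sₙ]} E_{θ₀} Π(θ : ‖θ − θ₀‖ > Mₙ √(sₙ log n) | Y) → 0`. -/
theorem statement7 (s : ℕ → ℕ)
    (hsinf : Tendsto (fun n => (s n : ℝ)) atTop atTop)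
    (hs0 : Tendsto (fun n => (s n : ℝ) / n) atTop (nhds 0))
    (M : ℕ → ℝ) (hM : Tendsto M atTop atTop) :
    Tendsto
      (fun n => ⨆ θ0 ∈ nearlyBlack n (s n),
        seqPostExp n
          (horseshoePrior n (((s n : ℝ) / n) * Real.sqrt (Real.log ((n : ℝ) / (s n : ℝ)))))
          θ0
          {θ | M n * Real.sqrt ((s n : ℝ) * Real.log n) <
            Real.sqrt (∑ i, (θ i - θ0 i) ^ 2)})
      atTop (nhds 0) := by
  have hbound : Tendsto (fun n => ENNReal.ofReal (80000000 / M n ^ 2)) atTop (nhds 0) := by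
    rw [← ENNReal.ofReal_zero]
    exact ENNReal.tendsto_ofReal
      (tendsto_const_nhds.div_atTop ((tendsto_pow_atTop two_ne_zero).comp hM))
  refine tendsto_of_tendsto_of_tendsto_of_le_of_le' tendsto_const_nhds hbound
    (Eventually.of_forall fun _ => zero_le) ?_
  filter_upwards [hsinf.eventually_ge_atTop 1, hs0.eventually_le_const (Real.exp_pos (-2)),
    eventually_gt_atTop 0, hM.eventually_gt_atTop 0] with n hs hsn hn hMn
  have hn' : (0 : ℝ) < n := by exact_mod_cast hn
  obtain ⟨L, hL, hτ, hLn, hrate⟩ := global_param_bounds hs hn' hsn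
  rw [hτ]
  refine iSup₂_le fun θ0 hθ0 => ?_
  have hlog : 0 < Real.log n := by linarith
  have hsl : 0 < (s n : ℝ) * Real.log n := by positivity
  have : IsFiniteMeasure (horseshoeMeasure (Real.exp (-L))) :=
    isFiniteMeasure_horseshoeMeasure (Real.exp_pos _)
  have hτ1 : Real.exp (-L) ≤ 1 := Real.exp_le_one_iff.2 (by linarith)
  refine (seqPostExp_le (horseshoeMeasure (Real.exp (-L)))
    (coordMarginal_horseshoeMeasure_ne_zero (Real.exp_pos _) hτ1) θ0
    (mul_pos hMn (Real.sqrt_pos.2 hsl))).trans ?_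
  rw [mul_pow, Real.sq_sqrt hsl.le]
  refine (ENNReal.div_le_div_right (sum_coordRisk_le hL hθ0) _).trans ?_
  rw [← ENNReal.ofReal_div_of_pos (by positivity)]
  refine ENNReal.ofReal_le_ofReal ?_
  rw [div_le_div_iff₀ (by positivity) (by positivity)]
  have hsL : (s n : ℝ) * L ≤ s n * Real.log n := by gcongr
  nlinarith [mul_le_mul_of_nonneg_right
    (show n * (30000000 * (Real.exp (-L) * Real.sqrt (2 * L))) + s n * (20000000 * L) ≤
      80000000 * ((s n : ℝ) * Real.log n) by linarith) (sq_nonneg (M n))]
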